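/- The sequence n ↦ μ₅(n)/C(n,5) converges as n → ∞, and its limit c₅ satisfies c₅ ≥ (5·√5 − 11)/4. -/

import Mathlib

open Finset

/-- A finite set of points in the plane is in *general position* if no three of
its points are collinear. -/
def GenPos (P : Finset (ℝ × ℝ)) : Prop :=
  ∀ x ∈ P, ∀ y ∈ P, ∀ z ∈ P, x ≠ y → x ≠ z → y ≠ z →
    ¬ Collinear ℝ ({x, y, z} : Set (ℝ × ℝ))

/-- A finite set of points is in *convex position* if every point of it is an
extreme point of its convex hull. -/
def ConvexPos (S : Finset (ℝ × ℝ)) : Prop :=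
  ∀ x ∈ S, x ∈ Set.extremePoints ℝ (convexHull ℝ (S : Set (ℝ × ℝ)))

open scoped Classical in
/-- Number of `k`-element subsets of `P` that are in convex position. -/
noncomputable def convexPosCount (P : Finset (ℝ × ℝ)) (k : ℕ) : ℕ :=
  ((P.powersetCard k).filter fun S => ConvexPos S).card

/-- `mu k n` is the minimum number of `k`-element subsets in convex position over
all placements of `n` points in general position. -/
noncomputable def mu (k n : ℕ) : ℕ :=
  sInf {m | ∃ P : Finset (ℝ × ℝ), GenPos P ∧ P.card = n ∧ convexPosCount P k = m}

/-- `x` is a γ-point of `T` if `T ∪ {x}` is in convex position. -/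
def IsGammaPt (T : Finset (ℝ × ℝ)) (x : ℝ × ℝ) : Prop :=
  ConvexPos (insert x T)

/-- `x` is a β-point of `T` if `T ∪ {x}` is not in convex position and `x` does not
lie in the convex hull of `T`. -/
def IsBetaPt (T : Finset (ℝ × ℝ)) (x : ℝ × ℝ) : Prop :=
  ¬ ConvexPos (insert x T) ∧ x ∉ convexHull ℝ (T : Set (ℝ × ℝ))

open scoped Classical in
/-- `γ_T`: number of γ-points of `T` among the points of `P \ T`. -/
noncomputable def gammaCount (P T : Finset (ℝ × ℝ)) : ℕ :=
  ((P \ T).filter fun x => IsGammaPt T x).card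

open scoped Classical in
/-- `β_T`: number of β-points of `T` among the points of `P \ T`. -/
noncomputable def betaCount (P T : Finset (ℝ × ℝ)) : ℕ :=
  ((P \ T).filter fun x => IsBetaPt T x).card

open scoped Classical in
/-- Number of `k`-element subsets of `P` whose convex hull has exactly `j`
extreme points. -/
noncomputable def hullCount (P : Finset (ℝ × ℝ)) (k j : ℕ) : ℕ :=
  ((P.powersetCard k).filter fun S =>
    (Set.extremePoints ℝ (convexHull ℝ (S : Set (ℝ × ℝ)))).ncard = j).card

/-- `x` and `y` lie strictly on the same side of the line through `p` and `q`. -/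
def SameSide (p q x y : ℝ × ℝ) : Prop :=
  0 < ((q.1 - p.1) * (x.2 - p.2) - (q.2 - p.2) * (x.1 - p.1)) *
      ((q.1 - p.1) * (y.2 - p.2) - (q.2 - p.2) * (y.1 - p.1))

/-- `x` and `y` lie in the same region with respect to `T`: for each pair of
distinct points of `T`, they lie strictly on the same side of the line through them. -/
def SameRegion (T : Finset (ℝ × ℝ)) (x y : ℝ × ℝ) : Prop :=
  ∀ p ∈ T, ∀ q ∈ T, p ≠ q → SameSide p q x y

open scoped Classical in
/-- Number of 2-element subsets `{x, y}` of `P \ T` such that `x` and `y` are both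
γ-points of `T` lying in the same region with respect to `T`. -/
noncomputable def gammaSamePairs (P T : Finset (ℝ × ℝ)) : ℕ :=
  (((P \ T).powersetCard 2).filter fun S =>
    (∀ x ∈ S, IsGammaPt T x) ∧ ∀ x ∈ S, ∀ y ∈ S, x ≠ y → SameRegion T x y).card

open scoped Classical in
/-- Number of 2-element subsets `{x, y}` of `P \ T` such that `x` and `y` are both
γ-points of `T` lying in distinct regions with respect to `T`. -/
noncomputable def gammaDiffPairs (P T : Finset (ℝ × ℝ)) : ℕ :=
  (((P \ T).powersetCard 2).filter fun S =>
    (∀ x ∈ S, IsGammaPt T x) ∧ ∀ x ∈ S, ∀ y ∈ S, x ≠ y → ¬ SameRegion T x y).card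

open scoped Classical in
/-- Number of 2-element subsets `{x, y}` of `P \ T` such that `x` and `y` are both
β-points of `T` lying in the same region with respect to `T`. -/
noncomputable def betaSamePairs (P T : Finset (ℝ × ℝ)) : ℕ :=
  (((P \ T).powersetCard 2).filter fun S =>
    (∀ x ∈ S, IsBetaPt T x) ∧ ∀ x ∈ S, ∀ y ∈ S, x ≠ y → SameRegion T x y).card

open scoped Classical in
/-- Number of 2-element subsets `{x, y}` of `P \ T` such that `x` and `y` are both
β-points of `T` lying in distinct regions with respect to `T`. -/
noncomputable def betaDiffPairs (P T : Finset (ℝ × ℝ)) : ℕ :=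
  (((P \ T).powersetCard 2).filter fun S =>
    (∀ x ∈ S, IsBetaPt T x) ∧ ∀ x ∈ S, ∀ y ∈ S, x ≠ y → ¬ SameRegion T x y).card

/-- Twice the signed area of the triangle `a b c`. -/
def orient (a b c : ℝ × ℝ) : ℝ :=
  (b.1 - a.1) * (c.2 - a.2) - (b.2 - a.2) * (c.1 - a.1)

theorem collinear_iff_orient_eq_zero {a b : ℝ × ℝ} (hab : a ≠ b) (c : ℝ × ℝ) :
    Collinear ℝ ({a, b, c} : Set (ℝ × ℝ)) ↔ orient a b c = 0 := by
  rw [collinear_iff_of_mem (p₀ := a) (by simp)]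
  constructor
  · rintro ⟨v, hv⟩
    obtain ⟨r, hr⟩ := hv b (by simp)
    obtain ⟨t, ht⟩ := hv c (by simp)
    subst hr ht
    simp [orient]
    ring
  · intro h
    refine ⟨b - a, ?_⟩
    have hz : b - a ≠ 0 := sub_ne_zero.2 hab.symm
    have key : ∃ r : ℝ, c = r • (b - a) + a := by
      unfold orient at h
      by_cases h1 : b.1 - a.1 = 0
      · have h2 : b.2 - a.2 ≠ 0 := fun h2 => hz (Prod.ext h1 h2)
        refine ⟨(c.2 - a.2) / (b.2 - a.2), Prod.ext ?_ ?_⟩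
        · rw [h1] at h
          have : c.1 - a.1 = 0 := by
            rcases mul_eq_zero.1 (show (b.2 - a.2) * (c.1 - a.1) = 0 by linarith) with h | h
            · exact absurd h h2
            · exact h
          simp [h1]
          linarith
        · simp
          field_simp
          ring
      · refine ⟨(c.1 - a.1) / (b.1 - a.1), Prod.ext ?_ ?_⟩
        · simp
          field_simp
          ring
        · simp
          field_simp
          linarith
    simp only [Set.mem_insert_iff, Set.mem_singleton_iff, vadd_eq_add, forall_eq_or_imp, forall_eq]
    exact ⟨⟨0, by simp⟩, ⟨1, by simp⟩, key⟩

theorem GenPos.orient_ne_zero {P : Finset (ℝ × ℝ)} (hP : GenPos P) {a b c : ℝ × ℝ}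
    (ha : a ∈ P) (hb : b ∈ P) (hc : c ∈ P) (hab : a ≠ b) (hac : a ≠ c) (hbc : b ≠ c) :
    orient a b c ≠ 0 := fun h =>
  hP a ha b hb c hc hab hac hbc ((collinear_iff_orient_eq_zero hab c).2 h)

theorem GenPos.mono {P Q : Finset (ℝ × ℝ)} (hP : GenPos P) (h : Q ⊆ P) : GenPos Q :=
  fun x hx y hy z hz => hP x (h hx) y (h hy) z (h hz)

theorem exists_genPos_card (n : ℕ) : ∃ P : Finset (ℝ × ℝ), GenPos P ∧ P.card = n := by
  refine ⟨(Finset.range n).image fun i : ℕ => ((i : ℝ), (i : ℝ) ^ 2), ?_, ?_⟩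
  swap
  · rw [Finset.card_image_of_injective, Finset.card_range]
    exact fun i j h => by simpa using congrArg Prod.fst h
  intro x hx y hy z hz hxy hxz hyz
  rw [collinear_iff_orient_eq_zero hxy]
  simp only [Finset.mem_image] at hx hy hz
  obtain ⟨i, -, rfl⟩ := hx
  obtain ⟨j, -, rfl⟩ := hy
  obtain ⟨k, -, rfl⟩ := hz
  have hij : (j : ℝ) - i ≠ 0 := fun h => hxy (by rw [sub_eq_zero.1 h])
  have hik : (k : ℝ) - i ≠ 0 := fun h => hxz (by rw [sub_eq_zero.1 h])
  have hjk : (k : ℝ) - j ≠ 0 := fun h => hyz (by rw [sub_eq_zero.1 h])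
  have : orient ((i : ℝ), (i : ℝ) ^ 2) ((j : ℝ), (j : ℝ) ^ 2) ((k : ℝ), (k : ℝ) ^ 2)
      = ((j : ℝ) - i) * ((k : ℝ) - i) * ((k : ℝ) - j) := by
    simp only [orient]
    ring
  rw [this]
  exact mul_ne_zero (mul_ne_zero hij hik) hjk

theorem mem_convexHull_triple_iff {a b c d : ℝ × ℝ} (habc : orient a b c ≠ 0)
    (habd : orient a b d ≠ 0) (hacd : orient a c d ≠ 0) (hbcd : orient b c d ≠ 0) :
    d ∈ convexHull ℝ ({a, b, c} : Set (ℝ × ℝ)) ↔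
      (0 < orient a b d ↔ 0 < orient b c d) ∧ (0 < orient a b d ↔ ¬ 0 < orient a c d) := by
  have hsum : orient a b c = orient b c d - orient a c d + orient a b d := by
    simp only [orient]
    ring
  constructor
  · intro h
    rw [convexHull_insert (by simp), convexHull_pair] at h
    simp only [convexJoin_singleton_left, Set.mem_iUnion] at h
    obtain ⟨e, ⟨u, v, hu, hv, huv, rfl⟩, ⟨r, t, hr, ht, hrt, rfl⟩⟩ := h
    have e1 : orient a b (r • a + t • (u • b + v • c)) = (t * v) * orient a b c := by
      obtain rfl : r = 1 - t := by linarith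
      obtain rfl : u = 1 - v := by linarith
      simp [orient]
      ring
    have e2 : orient b c (r • a + t • (u • b + v • c)) = r * orient a b c := by
      obtain rfl : r = 1 - t := by linarith
      obtain rfl : u = 1 - v := by linarith
      simp [orient]
      ring
    have e3 : orient a c (r • a + t • (u • b + v • c)) = -((t * u) * orient a b c) := by
      obtain rfl : r = 1 - t := by linarith
      obtain rfl : u = 1 - v := by linarith
      simp [orient]
      ring
    rw [e1] at habd ⊢
    rw [e2] at hbcd ⊢
    rw [e3] at hacd ⊢
    have p1 : 0 < t * v := lt_of_le_of_ne (by positivity) (Ne.symm (left_ne_zero_of_mul habd))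
    have p2 : 0 < r := lt_of_le_of_ne hr (Ne.symm (left_ne_zero_of_mul hbcd))
    have p3 : 0 < t * u :=
      lt_of_le_of_ne (by positivity) (Ne.symm (left_ne_zero_of_mul (neg_ne_zero.1 hacd)))
    rw [mul_pos_iff_of_pos_left p1, mul_pos_iff_of_pos_left p2, not_lt, neg_nonpos,
      mul_nonneg_iff_of_pos_left p3]
    exact ⟨Iff.rfl, le_of_lt, fun h => lt_of_le_of_ne h habc.symm⟩
  · rintro ⟨h1, h2⟩
    have w1 : 0 < orient b c d / orient a b c ∧ 0 < -orient a c d / orient a b c ∧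
        0 < orient a b d / orient a b c := by
      rcases lt_or_gt_of_ne habd with h | h
      · have k1 : orient b c d < 0 :=
          lt_of_le_of_ne (not_lt.1 fun h' => absurd (h1.2 h') (not_lt.2 h.le)) hbcd
        have k2 : 0 < orient a c d := by
          by_contra h'
          exact absurd (h2.2 h') (not_lt.2 h.le)
        have k3 : orient a b c < 0 := by linarith
        exact ⟨div_pos_of_neg_of_neg k1 k3, div_pos_of_neg_of_neg (by linarith) k3,
          div_pos_of_neg_of_neg h k3⟩
      · have k1 : 0 < orient b c d := h1.1 h
        have k2 : orient a c d < 0 := lt_of_le_of_ne (not_lt.1 (h2.1 h)) hacd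
        have k3 : 0 < orient a b c := by linarith
        exact ⟨div_pos k1 k3, div_pos (by linarith) k3, div_pos h k3⟩
    have hd : d = (orient b c d / orient a b c) • a + (-orient a c d / orient a b c) • b +
        (orient a b d / orient a b c) • c := by
      refine Prod.ext ?_ ?_
      · simp
        field_simp
        simp only [orient]
        ring
      · simp
        field_simp
        simp only [orient]
        ring
    have hs : orient b c d / orient a b c + -orient a c d / orient a b c +
        orient a b d / orient a b c = 1 := by
      field_simp
      linarith
    generalize orient b c d / orient a b c = u at *
    generalize -orient a c d / orient a b c = v at *
    generalize orient a b d / orient a b c = w at *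
    rw [hd]
    have hc := convex_convexHull ℝ ({a, b, c} : Set (ℝ × ℝ))
    have := hc.sum_mem (t := (Finset.univ : Finset (Fin 3))) (w := ![u, v, w]) (z := ![a, b, c])
      (by intro i _; fin_cases i <;> simp <;> linarith) (by simp [Fin.sum_univ_three, hs])
      (by intro i _; fin_cases i <;> simp <;> exact subset_convexHull ℝ _ (by simp))
    simpa [Fin.sum_univ_three] using this

theorem exists_mem_convexHull_of_not_convexPos {S : Finset (ℝ × ℝ)} (hS : 4 ≤ S.card)
    (h : ¬ ConvexPos S) :
    ∃ x ∈ S, ∃ T ⊆ S.erase x, T.card = 3 ∧ x ∈ convexHull ℝ (T : Set (ℝ × ℝ)) := by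
  classical
  simp only [ConvexPos, not_forall] at h
  obtain ⟨x, hx, hne⟩ := h
  have hmem : x ∈ convexHull ℝ ((S : Set (ℝ × ℝ)) \ {x}) := by
    have hsub : Set.extremePoints ℝ (convexHull ℝ (S : Set (ℝ × ℝ))) ⊆ (S : Set (ℝ × ℝ)) \ {x} :=
      fun y hy => ⟨extremePoints_convexHull_subset hy, fun hyx => hne (hyx ▸ hy)⟩
    have hcl : IsClosed (convexHull ℝ ((S : Set (ℝ × ℝ)) \ {x})) :=
      ((S.finite_toSet.subset Set.sdiff_subset).isCompact_convexHull ℝ).isClosed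
    have hmem : x ∈ convexHull ℝ (S : Set (ℝ × ℝ)) := subset_convexHull ℝ _ hx
    rw [← closure_convexHull_extremePoints (S.finite_toSet.isCompact_convexHull ℝ)
      (convex_convexHull ℝ _)] at hmem
    exact hcl.closure_subset_iff.2 (convexHull_mono hsub) hmem
  rw [← Finset.coe_erase, convexHull_eq_union] at hmem
  simp only [Set.mem_iUnion] at hmem
  obtain ⟨t, hts, hind, hxt⟩ := hmem
  have hcard : t.card ≤ 3 := by
    have := hind.card_le_finrank_succ
    simpa using this.trans (Nat.succ_le_succ (Submodule.finrank_le _))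
  obtain ⟨T, htT, hTS, hT⟩ := Finset.exists_subsuperset_card_eq (s := t) (t := S.erase x) (n := 3)
    (by exact_mod_cast hts) hcard (by rw [Finset.card_erase_of_mem hx]; omega)
  exact ⟨x, hx, T, hTS, hT, convexHull_mono (by exact_mod_cast htT) hxt⟩

/-- The weight of the fourth point `d` with respect to the triangle `a b c`, computed from the
orientations of `abc`, `abd`, `acd`, `bcd` and encoded by the coefficients of
`u + v * (2 - √5)`. -/
def weightCode (A B C D : Bool) : ℤ × ℤ :=
  if B = D ∧ B = !C then (0, 1)
  else if (A = C ∧ A = !D) ∨ (A = !B ∧ A = !D) ∨ (A = C ∧ A = !B) then (-1, 0)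
  else (1, 0)

/-- The product of two linear polynomials given by their coefficients. -/
def codeMul (p q : ℤ × ℤ) : ℤ × ℤ × ℤ := (p.1 * q.1, p.1 * q.2 + p.2 * q.1, p.2 * q.2)

/-- The signs are compatible with a three-term Grassmann–Plücker relation
`x1 * x2 - x3 * x4 + x5 * x6 = 0`. -/
def plucker (x1 x2 x3 x4 x5 x6 : Bool) : Bool :=
  !((x1 == x2) && (x3 != x4) && (x5 == x6)) && !((x1 != x2) && (x3 == x4) && (x5 != x6))

/-- The signs are compatible with the relation `A - B + C - D = 0` between the orientations of the
triangles spanned by four points. -/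
def acyclic (A B C D : Bool) : Bool := !(A && !B && C && !D) && !(!A && B && !C && D)

/-- The sum, over all pairs of points among five, of the products of the weights of both points with
respect to the triangle formed by the other three points, computed from the ten orientations. -/
def codeSum (b012 b013 b014 b023 b024 b034 b123 b124 b134 b234 : Bool) : ℤ × ℤ × ℤ :=
    codeMul (weightCode b012 b013 b023 b123) (weightCode b012 b014 b024 b124) +
    codeMul (weightCode b013 b012 (!b023) (!b123)) (weightCode b013 b014 b034 b134) +
    codeMul (weightCode b014 b012 (!b024) (!b124)) (weightCode b014 b013 (!b034) (!b134)) +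
    codeMul (weightCode b023 (!b012) (!b013) b123) (weightCode b023 b024 b034 b234) +
    codeMul (weightCode b024 (!b012) (!b014) b124) (weightCode b024 b023 (!b034) (!b234)) +
    codeMul (weightCode b034 (!b013) (!b014) b134) (weightCode b034 (!b023) (!b024) b234) +
    codeMul (weightCode b123 b012 b013 b023) (weightCode b123 b124 b134 b234) +
    codeMul (weightCode b124 b012 b014 b024) (weightCode b124 b123 (!b134) (!b234)) +
    codeMul (weightCode b134 b013 b014 b034) (weightCode b134 (!b123) (!b124) b234) +
    codeMul (weightCode b234 b023 b024 b034) (weightCode b234 b123 b124 b134)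

theorem sum_codeMul_weightCode (b012 b013 b014 b023 b024 b034 b123 b124 b134 b234 : Bool)
    (h0 : plucker b012 b034 b013 b024 b014 b023)
    (h1 : plucker b012 b134 b013 b124 b014 b123)
    (h2 : plucker b012 b234 b023 b124 b024 b123)
    (h3 : plucker b013 b234 b023 b134 b034 b123)
    (h4 : plucker b014 b234 b024 b134 b034 b124)
    (q4 : acyclic b012 b013 b023 b123)
    (q3 : acyclic b012 b014 b024 b124)
    (q2 : acyclic b013 b014 b034 b134)
    (q1 : acyclic b023 b024 b034 b234)
    (q0 : acyclic b123 b124 b134 b234)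
    (hin : b013 = b123) (hin' : b013 = !b023) :
    codeSum b012 b013 b014 b023 b024 b034 b123 b124 b134 b234 = (-1, -2, 1) ∨
      codeSum b012 b013 b014 b023 b024 b034 b123 b124 b134 b234 = (0, 2, 0) := by
  revert b012 b013 b014 b023 b024 b034 b123 b124 b134 b234
  decide

theorem plucker_of_relation {x1 x2 x3 x4 x5 x6 : ℝ} (h1 : x1 ≠ 0) (h2 : x2 ≠ 0) (h3 : x3 ≠ 0)
    (h4 : x4 ≠ 0) (h5 : x5 ≠ 0) (h6 : x6 ≠ 0) (h : x1 * x2 - x3 * x4 + x5 * x6 = 0) :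
    plucker (decide (0 < x1)) (decide (0 < x2)) (decide (0 < x3)) (decide (0 < x4))
      (decide (0 < x5)) (decide (0 < x6)) := by
  have key : ∀ x y : ℝ, x ≠ 0 → y ≠ 0 →
      (decide (0 < x) = decide (0 < y) ∧ 0 < x * y ∨
        decide (0 < x) = (!decide (0 < y)) ∧ x * y < 0) := by
    intro x y hx hy
    rcases lt_or_gt_of_ne hx with hx | hx <;> rcases lt_or_gt_of_ne hy with hy | hy <;>
      simp [hx, hy, hx.le, hy.le, not_lt.2, mul_pos_of_neg_of_neg, mul_neg_of_neg_of_pos,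
        mul_neg_of_pos_of_neg]
  rcases key _ _ h1 h2 with ⟨e1, f1⟩ | ⟨e1, f1⟩ <;>
    rcases key _ _ h3 h4 with ⟨e2, f2⟩ | ⟨e2, f2⟩ <;>
    rcases key _ _ h5 h6 with ⟨e3, f3⟩ | ⟨e3, f3⟩ <;> rw [e1, e2, e3] <;>
    first
    | exfalso; linarith
    | simp [plucker]

theorem acyclic_of_relation {A B C D : ℝ} (h : A - B + C - D = 0) :
    acyclic (decide (0 < A)) (decide (0 < B)) (decide (0 < C)) (decide (0 < D)) := by
  by_contra hcon
  have hcon : (0 < A ∧ B ≤ 0 ∧ 0 < C ∧ D ≤ 0) ∨ (A ≤ 0 ∧ 0 < B ∧ C ≤ 0 ∧ 0 < D) := by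
    simp [acyclic] at hcon
    grind
  grind

theorem orient_rotate (a b c : ℝ × ℝ) : orient b c a = orient a b c := by
  simp only [orient]
  ring

theorem orient_swap (a b c : ℝ × ℝ) : orient a c b = -orient a b c := by
  simp only [orient]
  ring

open scoped Classical in
/-- The weight of a point `x` with respect to a triangle `T`: it is `1` if the four points are in
convex position, `2 - √5` if `x` lies in the triangle, and `-1` otherwise. -/
noncomputable def weight (T : Finset (ℝ × ℝ)) (x : ℝ × ℝ) : ℝ :=
  if x ∈ convexHull ℝ (T : Set (ℝ × ℝ)) then 2 - Real.sqrt 5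
  else if ∃ t ∈ T, t ∈ convexHull ℝ (insert x ((T : Set (ℝ × ℝ)) \ {t})) then -1
  else 1

theorem two_sub_sqrt_five_bounds : -1 ≤ 2 - Real.sqrt 5 ∧ 2 - Real.sqrt 5 ≤ 0 := by
  have h1 : Real.sqrt 5 ≤ 3 := Real.sqrt_le_iff.2 (by norm_num)
  have h2 : 2 ≤ Real.sqrt 5 := Real.le_sqrt_of_sq_le (by norm_num)
  constructor <;> linarith

theorem abs_weight_le_one (T : Finset (ℝ × ℝ)) (x : ℝ × ℝ) : |weight T x| ≤ 1 := by
  have := two_sub_sqrt_five_bounds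
  unfold weight
  split_ifs
  · rw [abs_le]
    constructor <;> linarith
  · simp
  · simp

theorem weight_mul_weight_le_one (T : Finset (ℝ × ℝ)) (x y : ℝ × ℝ) :
    weight T x * weight T y ≤ 1 :=
  (le_abs_self _).trans <| by
    rw [abs_mul]
    exact mul_le_one₀ (abs_weight_le_one T x) (abs_nonneg _) (abs_weight_le_one T y)

/-- The number encoded by a linear code. -/
noncomputable def codeVal (p : ℤ × ℤ) : ℝ := p.1 + p.2 * (2 - Real.sqrt 5)

/-- The number encoded by a quadratic code. -/
noncomputable def codeVal₂ (p : ℤ × ℤ × ℤ) : ℝ :=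
  p.1 + p.2.1 * (2 - Real.sqrt 5) + p.2.2 * (2 - Real.sqrt 5) ^ 2

theorem codeVal₂_add (p q : ℤ × ℤ × ℤ) : codeVal₂ (p + q) = codeVal₂ p + codeVal₂ q := by
  simp [codeVal₂]
  ring

theorem codeVal₂_codeMul (p q : ℤ × ℤ) : codeVal₂ (codeMul p q) = codeVal p * codeVal q := by
  simp [codeVal, codeVal₂, codeMul]
  ring

theorem zero_lt_neg_iff_not {x : ℝ} (hx : x ≠ 0) : 0 < -x ↔ ¬ 0 < x := by
  rw [not_lt, neg_pos]
  exact ⟨le_of_lt, fun h => lt_of_le_of_ne h hx⟩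

theorem weight_eq_codeVal {a b c d : ℝ × ℝ} (hab : a ≠ b) (hac : a ≠ c) (hbc : b ≠ c)
    (habc : orient a b c ≠ 0)
    (habd : orient a b d ≠ 0) (hacd : orient a c d ≠ 0) (hbcd : orient b c d ≠ 0) :
    weight {a, b, c} d = codeVal (weightCode (decide (0 < orient a b c))
      (decide (0 < orient a b d)) (decide (0 < orient a c d)) (decide (0 < orient b c d))) := by
  have hex : (∃ t ∈ ({a, b, c} : Finset (ℝ × ℝ)),
      t ∈ convexHull ℝ (insert d ((({a, b, c} : Finset (ℝ × ℝ)) : Set (ℝ × ℝ)) \ {t}))) ↔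
      a ∈ convexHull ℝ ({b, c, d} : Set (ℝ × ℝ)) ∨ b ∈ convexHull ℝ ({a, c, d} : Set (ℝ × ℝ)) ∨
        c ∈ convexHull ℝ ({a, b, d} : Set (ℝ × ℝ)) := by
    have s1 : (insert d ((({a, b, c} : Finset (ℝ × ℝ)) : Set (ℝ × ℝ)) \ {a})) = {b, c, d} := by
      ext z
      simp
      grind
    have s2 : (insert d ((({a, b, c} : Finset (ℝ × ℝ)) : Set (ℝ × ℝ)) \ {b})) = {a, c, d} := by
      ext z
      simp
      grind
    have s3 : (insert d ((({a, b, c} : Finset (ℝ × ℝ)) : Set (ℝ × ℝ)) \ {c})) = {a, b, d} := by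
      ext z
      simp
      grind
    simp only [Finset.mem_insert, Finset.mem_singleton, exists_eq_or_imp, exists_eq_left, s1, s2,
      s3]
  have e1 : orient b c a = orient a b c := orient_rotate a b c
  have e2 : orient b d a = orient a b d := orient_rotate a b d
  have e3 : orient c d a = orient a c d := orient_rotate a c d
  have e4 : orient c d b = orient b c d := orient_rotate b c d
  have e5 : orient a c b = -orient a b c := orient_swap a b c
  have e6 : orient a d b = -orient a b d := orient_swap a b d
  have e7 : orient a d c = -orient a c d := orient_swap a c d
  have e8 : orient b d c = -orient b c d := orient_swap b c d
  have hd := mem_convexHull_triple_iff habc habd hacd hbcd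
  have ha := mem_convexHull_triple_iff (a := b) (b := c) (c := d) (d := a) hbcd
    (by rwa [e1]) (by rwa [e2]) (by rwa [e3])
  have hb := mem_convexHull_triple_iff (a := a) (b := c) (c := d) (d := b) hacd
    (by rw [e5]; exact neg_ne_zero.2 habc) (by rw [e6]; exact neg_ne_zero.2 habd) (by rwa [e4])
  have hc := mem_convexHull_triple_iff (a := a) (b := b) (c := d) (d := c) habd
    habc (by rw [e7]; exact neg_ne_zero.2 hacd) (by rw [e8]; exact neg_ne_zero.2 hbcd)
  rw [e1, e2, e3] at ha
  rw [e4, e5, e6, zero_lt_neg_iff_not habc, zero_lt_neg_iff_not habd] at hb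
  rw [e7, e8, zero_lt_neg_iff_not hacd, zero_lt_neg_iff_not hbcd] at hc
  have hcoe : (({a, b, c} : Finset (ℝ × ℝ)) : Set (ℝ × ℝ)) = {a, b, c} := by simp
  rw [← hcoe] at hd
  have w1 : d ∈ convexHull ℝ (({a, b, c} : Finset (ℝ × ℝ)) : Set (ℝ × ℝ)) →
      weight {a, b, c} d = 2 - Real.sqrt 5 := fun h => if_pos h
  have w2 : d ∉ convexHull ℝ (({a, b, c} : Finset (ℝ × ℝ)) : Set (ℝ × ℝ)) →
      (a ∈ convexHull ℝ ({b, c, d} : Set (ℝ × ℝ)) ∨ b ∈ convexHull ℝ ({a, c, d} : Set (ℝ × ℝ)) ∨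
        c ∈ convexHull ℝ ({a, b, d} : Set (ℝ × ℝ))) → weight {a, b, c} d = -1 :=
    fun h h' => (if_neg h).trans (if_pos (hex.2 h'))
  have w3 : d ∉ convexHull ℝ (({a, b, c} : Finset (ℝ × ℝ)) : Set (ℝ × ℝ)) →
      ¬(a ∈ convexHull ℝ ({b, c, d} : Set (ℝ × ℝ)) ∨ b ∈ convexHull ℝ ({a, c, d} : Set (ℝ × ℝ)) ∨
        c ∈ convexHull ℝ ({a, b, d} : Set (ℝ × ℝ))) → weight {a, b, c} d = 1 :=
    fun h h' => (if_neg h).trans (if_neg (mt hex.1 h'))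
  rw [hd] at w1 w2 w3
  rw [ha, hb, hc] at w2 w3
  by_cases pA : 0 < orient a b c <;> by_cases pB : 0 < orient a b d <;>
    by_cases pC : 0 < orient a c d <;> by_cases pD : 0 < orient b c d <;>
    simp [pA, pB, pC, pD, weightCode, codeVal] at w1 w2 w3 ⊢ <;> assumption

theorem sum_powersetCard_three_offDiag (P : Finset (ℝ × ℝ))
    (h : Finset (ℝ × ℝ) → (ℝ × ℝ) × (ℝ × ℝ) → ℝ) :
    ∑ T ∈ P.powersetCard 3, ∑ z ∈ (P \ T).offDiag, h T z =
      ∑ S ∈ P.powersetCard 5, ∑ z ∈ S.offDiag, h (S \ {z.1, z.2}) z := by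
  rw [Finset.sum_sigma', Finset.sum_sigma']
  refine Finset.sum_bij' (fun w _ => ⟨w.1 ∪ {w.2.1, w.2.2}, w.2⟩)
    (fun w _ => ⟨w.1 \ {w.2.1, w.2.2}, w.2⟩) ?_ ?_ ?_ ?_ ?_
  · rintro ⟨T, x, y⟩ hw
    simp only [Finset.mem_sigma, Finset.mem_powersetCard, Finset.mem_offDiag, Finset.mem_sdiff]
      at hw ⊢
    obtain ⟨⟨hT, hc⟩, ⟨hx, hxT⟩, ⟨hy, hyT⟩, hxy⟩ := hw
    refine ⟨⟨?_, ?_⟩, by simp, by simp, hxy⟩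
    · intro z
      simp
      grind
    · rw [Finset.card_union_of_disjoint, hc, Finset.card_pair hxy]
      simp [hxT, hyT]
  · rintro ⟨S, x, y⟩ hw
    simp only [Finset.mem_sigma, Finset.mem_powersetCard, Finset.mem_offDiag, Finset.mem_sdiff]
      at hw ⊢
    obtain ⟨⟨hS, hc⟩, hx, hy, hxy⟩ := hw
    refine ⟨⟨Finset.sdiff_subset.trans hS, ?_⟩, ⟨hS hx, by simp⟩, ⟨hS hy, by simp⟩, hxy⟩
    rw [Finset.card_sdiff_of_subset, hc, Finset.card_pair hxy]
    intro z
    simp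
    grind
  · rintro ⟨T, x, y⟩ hw
    simp only [Finset.mem_sigma, Finset.mem_powersetCard, Finset.mem_offDiag, Finset.mem_sdiff]
      at hw
    have : (T ∪ {x, y}) \ {x, y} = T := by
      ext z
      simp
      grind
    dsimp only
    rw [this]
  · rintro ⟨S, x, y⟩ hw
    simp only [Finset.mem_sigma, Finset.mem_powersetCard, Finset.mem_offDiag] at hw
    have : S \ {x, y} ∪ {x, y} = S := by
      ext z
      simp
      grind
    dsimp only
    rw [this]
  · rintro ⟨T, x, y⟩ hw
    simp only [Finset.mem_sigma, Finset.mem_powersetCard, Finset.mem_offDiag, Finset.mem_sdiff]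
      at hw
    have : (T ∪ {x, y}) \ {x, y} = T := by
      ext z
      simp
      grind
    dsimp only
    rw [this]

theorem sum_weight_mul_weight_eq_of_embedding (e : Fin 5 ↪ ℝ × ℝ) (hP : GenPos (Finset.univ.map e))
    (hin : e 3 ∈ convexHull ℝ ({e 0, e 1, e 2} : Set (ℝ × ℝ))) :
    ∑ z ∈ (Finset.univ.map e).offDiag, weight (Finset.univ.map e \ {z.1, z.2}) z.1 *
      weight (Finset.univ.map e \ {z.1, z.2}) z.2 = 8 - 4 * Real.sqrt 5 := by
  have ho : ∀ i j k : Fin 5, i ≠ j → i ≠ k → j ≠ k → orient (e i) (e j) (e k) ≠ 0 := by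
    intro i j k hij hik hjk
    exact hP.orient_ne_zero (by simp) (by simp) (by simp) (e.injective.ne hij) (e.injective.ne hik)
      (e.injective.ne hjk)
  have hw : ∀ i j k l : Fin 5, i ≠ j → i ≠ k → i ≠ l → j ≠ k → j ≠ l → k ≠ l →
      weight {e i, e j, e k} (e l) = codeVal (weightCode (decide (0 < orient (e i) (e j) (e k)))
        (decide (0 < orient (e i) (e j) (e l))) (decide (0 < orient (e i) (e k) (e l)))
        (decide (0 < orient (e j) (e k) (e l)))) := by
    intro i j k l hij hik hil hjk hjl hkl
    exact weight_eq_codeVal (e.injective.ne hij) (e.injective.ne hik) (e.injective.ne hjk)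
      (ho _ _ _ hij hik hjk) (ho _ _ _ hij hil hjl) (ho _ _ _ hik hil hkl) (ho _ _ _ hjk hjl hkl)
  have hswap : ∀ i j k : Fin 5, i ≠ j → i ≠ k → j ≠ k →
      decide (0 < orient (e i) (e k) (e j)) = !decide (0 < orient (e i) (e j) (e k)) := by
    intro i j k hij hik hjk
    rw [orient_swap, ← decide_not]
    exact decide_eq_decide.2 (zero_lt_neg_iff_not (ho i j k hij hik hjk))
  have hrot : ∀ i j k : Fin 5, orient (e j) (e k) (e i) = orient (e i) (e j) (e k) :=
    fun i j k => orient_rotate _ _ _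
  have hac : ∀ i j k l : Fin 5, acyclic (decide (0 < orient (e i) (e j) (e k)))
        (decide (0 < orient (e i) (e j) (e l))) (decide (0 < orient (e i) (e k) (e l)))
        (decide (0 < orient (e j) (e k) (e l))) := by
    intro i j k l
    refine acyclic_of_relation ?_
    simp only [orient]
    ring
  have hquad : ∀ i j k l : Fin 5, i < j → j < k → k < l →
      weight {e i, e j, e k} (e l) = codeVal (weightCode (decide (0 < orient (e i) (e j) (e k)))
        (decide (0 < orient (e i) (e j) (e l))) (decide (0 < orient (e i) (e k) (e l)))
        (decide (0 < orient (e j) (e k) (e l)))) ∧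
      weight {e i, e j, e l} (e k) = codeVal (weightCode (decide (0 < orient (e i) (e j) (e l)))
        (decide (0 < orient (e i) (e j) (e k))) (!decide (0 < orient (e i) (e k) (e l)))
        (!decide (0 < orient (e j) (e k) (e l)))) ∧
      weight {e i, e k, e l} (e j) = codeVal (weightCode (decide (0 < orient (e i) (e k) (e l)))
        (!decide (0 < orient (e i) (e j) (e k))) (!decide (0 < orient (e i) (e j) (e l)))
        (decide (0 < orient (e j) (e k) (e l)))) ∧
      weight {e j, e k, e l} (e i) = codeVal (weightCode (decide (0 < orient (e j) (e k) (e l)))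
        (decide (0 < orient (e i) (e j) (e k))) (decide (0 < orient (e i) (e j) (e l)))
        (decide (0 < orient (e i) (e k) (e l)))) := by
    intro i j k l hij' hjk' hkl'
    have hij := hij'.ne
    have hjk := hjk'.ne
    have hkl := hkl'.ne
    have hik := (hij'.trans hjk').ne
    have hjl := (hjk'.trans hkl').ne
    have hil := (hij'.trans (hjk'.trans hkl')).ne
    refine ⟨hw i j k l hij hik hil hjk hjl hkl, ?_, ?_, ?_⟩
    · rw [hw i j l k hij hil hik hjl hjk hkl.symm, hswap i k l hik hil hkl,
        hswap j k l hjk hjl hkl]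
    · rw [hw i k l j hik hil hij hkl hjk.symm hjl.symm, hswap i j k hij hik hjk,
        hswap i j l hij hil hjl, hrot j k l]
    · rw [hw j k l i hjk hjl hij.symm hkl hik.symm hil.symm, hrot i j k, hrot i j l, hrot i k l]
  have hmem := (mem_convexHull_triple_iff (ho 0 1 2 (by decide) (by decide) (by decide))
    (ho 0 1 3 (by decide) (by decide) (by decide)) (ho 0 2 3 (by decide) (by decide) (by decide))
    (ho 1 2 3 (by decide) (by decide) (by decide))).1 hin
  have hsum : ∑ z ∈ (Finset.univ.map e).offDiag, weight (Finset.univ.map e \ {z.1, z.2}) z.1 *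
      weight (Finset.univ.map e \ {z.1, z.2}) z.2 =
      ∑ z ∈ (Finset.univ : Finset (Fin 5)).offDiag,
        weight ((Finset.univ \ {z.1, z.2}).map e) (e z.1) *
        weight ((Finset.univ \ {z.1, z.2}).map e) (e z.2) := by
    have hmap : (Finset.univ.map e).offDiag =
        (Finset.univ : Finset (Fin 5)).offDiag.map (e.prodMap e) := by
      ext ⟨x, y⟩
      simp only [Finset.mem_offDiag, Finset.mem_map, Finset.mem_univ, true_and, Prod.exists,
        Function.Embedding.coe_prodMap, Prod.map_apply, Prod.mk.injEq]
      constructor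
      · rintro ⟨⟨i, rfl⟩, ⟨j, rfl⟩, hij⟩
        exact ⟨i, j, fun h => hij (by rw [h]), rfl, rfl⟩
      · rintro ⟨i, j, hij, rfl, rfl⟩
        exact ⟨⟨i, rfl⟩, ⟨j, rfl⟩, e.injective.ne hij⟩
    rw [hmap, Finset.sum_map]
    refine Finset.sum_congr rfl fun z _ => ?_
    simp [Finset.map_sdiff]
  have hoff : (Finset.univ : Finset (Fin 5)).offDiag =
      {(0, 1), (0, 2), (0, 3), (0, 4), (1, 2), (1, 3), (1, 4), (2, 3), (2, 4), (3, 4),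
       (1, 0), (2, 0), (3, 0), (4, 0), (2, 1), (3, 1), (4, 1), (3, 2), (4, 2), (4, 3)} := by
    decide
  have hcompl : ∀ i j k l m : Fin 5, (Finset.univ \ {i, j} : Finset (Fin 5)) = {k, l, m} →
      (Finset.univ \ {i, j} : Finset (Fin 5)).map e = {e k, e l, e m} ∧
      (Finset.univ \ {j, i} : Finset (Fin 5)).map e = {e k, e l, e m} := by
    intro i j k l m h
    rw [Finset.pair_comm j i, h]
    simp
  obtain ⟨s01, s10⟩ := hcompl 0 1 2 3 4 (by decide)
  obtain ⟨s02, s20⟩ := hcompl 0 2 1 3 4 (by decide)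
  obtain ⟨s03, s30⟩ := hcompl 0 3 1 2 4 (by decide)
  obtain ⟨s04, s40⟩ := hcompl 0 4 1 2 3 (by decide)
  obtain ⟨s12, s21⟩ := hcompl 1 2 0 3 4 (by decide)
  obtain ⟨s13, s31⟩ := hcompl 1 3 0 2 4 (by decide)
  obtain ⟨s14, s41⟩ := hcompl 1 4 0 2 3 (by decide)
  obtain ⟨s23, s32⟩ := hcompl 2 3 0 1 4 (by decide)
  obtain ⟨s24, s42⟩ := hcompl 2 4 0 1 3 (by decide)
  obtain ⟨s34, s43⟩ := hcompl 3 4 0 1 2 (by decide)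
  obtain ⟨w0123, w0132, w0231, w1230⟩ := hquad 0 1 2 3 (by decide) (by decide) (by decide)
  obtain ⟨w0124, w0142, w0241, w1240⟩ := hquad 0 1 2 4 (by decide) (by decide) (by decide)
  obtain ⟨w0134, w0143, w0341, w1340⟩ := hquad 0 1 3 4 (by decide) (by decide) (by decide)
  obtain ⟨w0234, w0243, w0342, w2340⟩ := hquad 0 2 3 4 (by decide) (by decide) (by decide)
  obtain ⟨w1234, w1243, w1342, w2341⟩ := hquad 1 2 3 4 (by decide) (by decide) (by decide)
  have o012 := ho 0 1 2 (by decide) (by decide) (by decide)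
  have o013 := ho 0 1 3 (by decide) (by decide) (by decide)
  have o014 := ho 0 1 4 (by decide) (by decide) (by decide)
  have o023 := ho 0 2 3 (by decide) (by decide) (by decide)
  have o024 := ho 0 2 4 (by decide) (by decide) (by decide)
  have o034 := ho 0 3 4 (by decide) (by decide) (by decide)
  have o123 := ho 1 2 3 (by decide) (by decide) (by decide)
  have o124 := ho 1 2 4 (by decide) (by decide) (by decide)
  have o134 := ho 1 3 4 (by decide) (by decide) (by decide)
  have o234 := ho 2 3 4 (by decide) (by decide) (by decide)
  have hcode := sum_codeMul_weightCode
    (decide (0 < orient (e 0) (e 1) (e 2)))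
    (decide (0 < orient (e 0) (e 1) (e 3)))
    (decide (0 < orient (e 0) (e 1) (e 4)))
    (decide (0 < orient (e 0) (e 2) (e 3)))
    (decide (0 < orient (e 0) (e 2) (e 4)))
    (decide (0 < orient (e 0) (e 3) (e 4)))
    (decide (0 < orient (e 1) (e 2) (e 3)))
    (decide (0 < orient (e 1) (e 2) (e 4)))
    (decide (0 < orient (e 1) (e 3) (e 4)))
    (decide (0 < orient (e 2) (e 3) (e 4)))
    (plucker_of_relation o012 o034 o013 o024 o014 o023
      (by simp only [orient]; ring))
    (plucker_of_relation o012 o134 o013 o124 o014 o123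
      (by simp only [orient]; ring))
    (plucker_of_relation o012 o234 o023 o124 o024 o123
      (by simp only [orient]; ring))
    (plucker_of_relation o013 o234 o023 o134 o034 o123
      (by simp only [orient]; ring))
    (plucker_of_relation o014 o234 o024 o134 o034 o124
      (by simp only [orient]; ring))
    (hac 0 1 2 3)
    (hac 0 1 2 4)
    (hac 0 1 3 4)
    (hac 0 2 3 4)
    (hac 1 2 3 4)
    (decide_eq_decide.2 hmem.1)
    (by rw [← decide_not]; exact decide_eq_decide.2 hmem.2)
  have htotal : ∑ z ∈ (Finset.univ : Finset (Fin 5)).offDiag,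
      weight ((Finset.univ \ {z.1, z.2}).map e) (e z.1) *
        weight ((Finset.univ \ {z.1, z.2}).map e) (e z.2) =
      2 * codeVal₂ (codeSum
        (decide (0 < orient (e 0) (e 1) (e 2)))
        (decide (0 < orient (e 0) (e 1) (e 3)))
        (decide (0 < orient (e 0) (e 1) (e 4)))
        (decide (0 < orient (e 0) (e 2) (e 3)))
        (decide (0 < orient (e 0) (e 2) (e 4)))
        (decide (0 < orient (e 0) (e 3) (e 4)))
        (decide (0 < orient (e 1) (e 2) (e 3)))
        (decide (0 < orient (e 1) (e 2) (e 4)))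
        (decide (0 < orient (e 1) (e 3) (e 4)))
        (decide (0 < orient (e 2) (e 3) (e 4)))) := by
    rw [hoff]
    iterate 19 rw [Finset.sum_insert (by decide)]
    rw [Finset.sum_singleton]
    simp only [s01, s02, s03, s04, s12, s13, s14, s23, s24, s34,
      s10, s20, s30, s40, s21, s31, s41, s32, s42, s43]
    rw [w1230, w0231, w0132, w0123, w1240, w0241, w0142, w0124,
      w1340, w0341, w0143, w0134, w2340, w0342, w0243, w0234, w2341, w1342, w1243, w1234]
    simp only [codeSum, codeVal₂_add, codeVal₂_codeMul]
    ring
  have h5 : Real.sqrt 5 ^ 2 = 5 := Real.sq_sqrt (by norm_num)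
  rw [hsum, htotal]
  rcases hcode with h | h <;> rw [h] <;> simp only [codeVal₂] <;> push_cast <;> linarith

theorem sum_weight_mul_weight_of_not_convexPos {S : Finset (ℝ × ℝ)} (hS : GenPos S)
    (hc : S.card = 5) (hconv : ¬ ConvexPos S) :
    ∑ z ∈ S.offDiag, weight (S \ {z.1, z.2}) z.1 * weight (S \ {z.1, z.2}) z.2 =
      8 - 4 * Real.sqrt 5 := by
  obtain ⟨x, hx, T, hT, hTc, hxT⟩ := exists_mem_convexHull_of_not_convexPos (by omega) hconv
  obtain ⟨y, hy⟩ : ∃ y, (S.erase x) \ T = {y} := by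
    rw [← Finset.card_eq_one, Finset.card_sdiff_of_subset hT, Finset.card_erase_of_mem hx]
    omega
  obtain ⟨a, b, c, hab, hac, hbc, rfl⟩ := Finset.card_eq_three.1 hTc
  have hyS : y ∈ S.erase x \ {a, b, c} := by simp [hy]
  simp only [Finset.mem_sdiff, Finset.mem_erase, Finset.mem_insert, Finset.mem_singleton,
    not_or] at hyS
  have haS := Finset.mem_erase.1 (hT (by simp : a ∈ ({a, b, c} : Finset (ℝ × ℝ))))
  have hbS := Finset.mem_erase.1 (hT (by simp : b ∈ ({a, b, c} : Finset (ℝ × ℝ))))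
  have hcS := Finset.mem_erase.1 (hT (by simp : c ∈ ({a, b, c} : Finset (ℝ × ℝ))))
  obtain ⟨⟨hyx, hyS⟩, hya, hyb, hyc⟩ := hyS
  have hinj : Function.Injective ![a, b, c, x, y] := by
    intro i j hij
    fin_cases i <;> fin_cases j <;> simp at hij ⊢ <;> grind
  have hmap : Finset.univ.map ⟨![a, b, c, x, y], hinj⟩ = S := by
    refine Finset.eq_of_subset_of_card_le ?_ (by simp [hc])
    intro z hz
    simp only [Finset.mem_map, Finset.mem_univ, true_and, Function.Embedding.coeFn_mk] at hz
    obtain ⟨i, rfl⟩ := hz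
    fin_cases i <;> simp [haS, hbS, hcS, hx, hyS]
  have := sum_weight_mul_weight_eq_of_embedding ⟨![a, b, c, x, y], hinj⟩ (by rwa [hmap])
    (by simpa using hxT)
  rwa [hmap] at this

open scoped Classical in
theorem convexPosCount_le_choose (P : Finset (ℝ × ℝ)) (k : ℕ) :
    convexPosCount P k ≤ P.card.choose k :=
  (Finset.card_filter_le _ _).trans (Finset.card_powersetCard k P).le

theorem GenPos.mul_choose_five_le {P : Finset (ℝ × ℝ)} (hP : GenPos P) :
    (4 * Real.sqrt 5 - 8) * (P.card.choose 5 : ℝ) - P.card * (P.card.choose 3 : ℝ) ≤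
      (12 + 4 * Real.sqrt 5) * convexPosCount P 5 := by
  classical
  have hsq : ∀ T ∈ P.powersetCard 3, (∑ x ∈ P \ T, weight T x) ^ 2 ≤
      P.card + ∑ z ∈ (P \ T).offDiag, weight T z.1 * weight T z.2 := by
    intro T _
    have hdiag : ∑ z ∈ (P \ T).diag, weight T z.1 * weight T z.2 ≤ (P.card : ℝ) :=
      calc ∑ z ∈ (P \ T).diag, weight T z.1 * weight T z.2 ≤ ∑ _z ∈ (P \ T).diag, (1 : ℝ) :=
            Finset.sum_le_sum fun z _ => weight_mul_weight_le_one T z.1 z.2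
        _ = ((P \ T).card : ℝ) := by simp [Finset.diag_card]
        _ ≤ P.card := by exact_mod_cast Finset.card_le_card Finset.sdiff_subset
    rw [sq, Finset.sum_mul_sum, ← Finset.sum_product', ← Finset.diag_union_offDiag,
      Finset.sum_union (Finset.disjoint_diag_offDiag _)]
    linarith
  have hle : ∀ S ∈ P.powersetCard 5,
      ∑ z ∈ S.offDiag, weight (S \ {z.1, z.2}) z.1 * weight (S \ {z.1, z.2}) z.2 ≤
        (8 - 4 * Real.sqrt 5) + if ConvexPos S then 12 + 4 * Real.sqrt 5 else 0 := by
    intro S hS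
    rw [Finset.mem_powersetCard] at hS
    split_ifs with hconv
    · refine (Finset.sum_le_sum fun z _ => weight_mul_weight_le_one _ z.1 z.2).trans ?_
      rw [Finset.sum_const, Finset.offDiag_card, hS.2]
      norm_num
    · rw [sum_weight_mul_weight_of_not_convexPos (hP.mono hS.1) hS.2 hconv, add_zero]
  have hpos : 0 ≤ ∑ T ∈ P.powersetCard 3, (∑ x ∈ P \ T, weight T x) ^ 2 :=
    Finset.sum_nonneg fun T _ => sq_nonneg _
  have h1 := hpos.trans (Finset.sum_le_sum hsq)
  rw [Finset.sum_add_distrib, sum_powersetCard_three_offDiag P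
    (fun T z => weight T z.1 * weight T z.2)] at h1
  have h2 := Finset.sum_le_sum hle
  rw [Finset.sum_add_distrib, ← Finset.sum_filter, Finset.sum_const, Finset.sum_const,
    Finset.card_powersetCard, nsmul_eq_mul, nsmul_eq_mul] at h2
  rw [Finset.sum_const, Finset.card_powersetCard, nsmul_eq_mul] at h1
  have h3 : (((P.powersetCard 5).filter fun S => ConvexPos S).card : ℝ) = convexPosCount P 5 := by
    unfold convexPosCount
    congr!
  rw [h3] at h2
  linarith

theorem mu_le {P : Finset (ℝ × ℝ)} (hP : GenPos P) (k : ℕ) : mu k P.card ≤ convexPosCount P k :=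
  Nat.sInf_le ⟨P, hP, rfl, rfl⟩

theorem exists_convexPosCount_eq_mu (k n : ℕ) :
    ∃ P : Finset (ℝ × ℝ), GenPos P ∧ P.card = n ∧ convexPosCount P k = mu k n := by
  obtain ⟨P, hP, hc⟩ := exists_genPos_card n
  exact Nat.sInf_mem (s := {m | ∃ P : Finset (ℝ × ℝ), GenPos P ∧ P.card = n ∧
    convexPosCount P k = m}) ⟨_, P, hP, hc, rfl⟩

open scoped Classical in
theorem sum_convexPosCount_erase (P : Finset (ℝ × ℝ)) (k : ℕ) :
    ∑ x ∈ P, convexPosCount (P.erase x) k = (P.card - k) * convexPosCount P k := by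
  have h : ∀ x ∈ P, convexPosCount (P.erase x) k =
      (((P.powersetCard k).filter fun S => ConvexPos S).filter fun S => x ∉ S).card := by
    intro x _
    unfold convexPosCount
    congr 1
    ext S
    simp only [Finset.mem_filter, Finset.mem_powersetCard, Finset.subset_erase]
    tauto
  rw [Finset.sum_congr rfl h]
  simp only [Finset.card_filter _ _]
  rw [Finset.sum_comm, mul_comm]
  have h' : ∀ S ∈ (P.powersetCard k).filter fun S => ConvexPos S,
      ∑ x ∈ P, (if x ∉ S then 1 else 0) = P.card - k := by
    intro S hS
    rw [Finset.mem_filter, Finset.mem_powersetCard] at hS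
    rw [← Finset.card_filter, ← Finset.sdiff_eq_filter, Finset.card_sdiff_of_subset hS.1.1, hS.1.2]
  rw [Finset.sum_congr rfl h', Finset.sum_const, smul_eq_mul]
  rfl

theorem succ_mul_mu_le (k n : ℕ) : (n + 1) * mu k n ≤ (n + 1 - k) * mu k (n + 1) := by
  obtain ⟨P, hP, hc, hmu⟩ := exists_convexPosCount_eq_mu k (n + 1)
  have h := sum_convexPosCount_erase P k
  rw [hc, hmu] at h
  rw [← h, ← hc, ← smul_eq_mul]
  refine Finset.card_nsmul_le_sum _ _ _ fun x hx => ?_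
  have hn : (P.erase x).card = n := by
    rw [Finset.card_erase_of_mem hx, hc, Nat.add_sub_cancel]
  exact hn ▸ mu_le (hP.mono (Finset.erase_subset x P)) k

theorem mu_le_choose (k n : ℕ) : mu k n ≤ n.choose k := by
  obtain ⟨P, -, hc, hmu⟩ := exists_convexPosCount_eq_mu k n
  exact hmu ▸ hc ▸ convexPosCount_le_choose P k

theorem mu_div_choose_le_one (k n : ℕ) : (mu k n : ℝ) / n.choose k ≤ 1 :=
  div_le_one_of_le₀ (by exact_mod_cast mu_le_choose k n) (Nat.cast_nonneg _)

theorem monotone_mu_div_choose (k : ℕ) :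
    Monotone fun m : ℕ => (mu k (m + k) : ℝ) / (m + k).choose k := by
  refine monotone_nat_of_le_succ fun m => ?_
  have h := succ_mul_mu_le k (m + k)
  have h' := Nat.choose_mul_succ_eq (m + k) k
  have e : m + k + 1 - k = m + 1 := by omega
  rw [e] at h h'
  have c1 : (0 : ℝ) < (m + k).choose k := by exact_mod_cast Nat.choose_pos (by omega)
  have c2 : (0 : ℝ) < (m + 1 + k).choose k := by exact_mod_cast Nat.choose_pos (by omega)
  rw [div_le_div_iff₀ c1 c2]
  rw [add_right_comm m k 1] at h h'
  have h1 : ((m + 1 + k : ℕ) : ℝ) * mu k (m + k) ≤ (m + 1 : ℕ) * mu k (m + 1 + k) := by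
    exact_mod_cast h
  have h2 : ((m + k).choose k : ℝ) * (m + 1 + k : ℕ) = (m + 1 + k).choose k * (m + 1 : ℕ) := by
    exact_mod_cast h'
  have hm : (0 : ℝ) < (m + 1 : ℕ) := by positivity
  refine le_of_mul_le_mul_right ?_ hm
  nlinarith

theorem mul_choose_three_div_choose_five_le (m : ℕ) :
    ((m + 5 : ℕ) : ℝ) * (m + 5).choose 3 / (m + 5).choose 5 ≤ 50 * (1 / ((m : ℝ) + 1)) := by
  have h3 := Nat.choose_succ_right_eq (m + 5) 3
  have h4 := Nat.choose_succ_right_eq (m + 5) 4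
  have e3 : m + 5 - 3 = m + 2 := by omega
  have e4 : m + 5 - 4 = m + 1 := by omega
  rw [e3] at h3
  rw [e4] at h4
  have c5 : (0 : ℝ) < (m + 5).choose 5 := by exact_mod_cast Nat.choose_pos (by omega)
  have h3' : ((m + 5).choose 4 : ℝ) * 4 = (m + 5).choose 3 * (m + 2) := by exact_mod_cast h3
  have h4' : ((m + 5).choose 5 : ℝ) * 5 = (m + 5).choose 4 * (m + 1) := by exact_mod_cast h4
  have hm : (0 : ℝ) ≤ m := Nat.cast_nonneg m
  have c3 : (0 : ℝ) ≤ (m + 5).choose 3 := Nat.cast_nonneg _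
  rw [mul_one_div, div_le_div_iff₀ c5 (by positivity)]
  have h5 : ((m + 5).choose 5 : ℝ) * 20 = (m + 5).choose 3 * (m + 2) * (m + 1) := by
    rw [← h3', mul_right_comm, ← h4']
    ring
  push_cast
  nlinarith [mul_nonneg (mul_nonneg c3 hm) hm, mul_nonneg c3 hm]

theorem five_mul_sqrt_five_sub_le (m : ℕ) :
    (5 * Real.sqrt 5 - 11) / 4 - 50 * (1 / ((m : ℝ) + 1)) ≤
      (mu 5 (m + 5) : ℝ) / (m + 5).choose 5 := by
  obtain ⟨P, hP, hc, hmu⟩ := exists_convexPosCount_eq_mu 5 (m + 5)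
  have h := hP.mul_choose_five_le
  rw [hc, hmu] at h
  have hbound := mul_choose_three_div_choose_five_le m
  have c5 : (0 : ℝ) < (m + 5).choose 5 := by exact_mod_cast Nat.choose_pos (by omega)
  have hs : Real.sqrt 5 ^ 2 = 5 := Real.sq_sqrt (by norm_num)
  have hs0 : 0 ≤ Real.sqrt 5 := Real.sqrt_nonneg 5
  have hpos : (0 : ℝ) < 12 + 4 * Real.sqrt 5 := by positivity
  have herr : (0 : ℝ) ≤ 50 * (1 / ((m : ℝ) + 1)) := by positivity
  rw [div_le_iff₀ c5] at hbound
  rw [le_div_iff₀ c5]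
  refine le_of_mul_le_mul_left ?_ hpos
  have hconst : (12 + 4 * Real.sqrt 5) * ((5 * Real.sqrt 5 - 11) / 4) = 4 * Real.sqrt 5 - 8 := by
    linear_combination 5 * hs
  have herr' := mul_nonneg (mul_nonneg herr c5.le) (by linarith : 0 ≤ 11 + 4 * Real.sqrt 5)
  calc _ = (12 + 4 * Real.sqrt 5) * ((5 * Real.sqrt 5 - 11) / 4) * (m + 5).choose 5 -
        (12 + 4 * Real.sqrt 5) * (50 * (1 / ((m : ℝ) + 1)) * (m + 5).choose 5) := by ring
    _ ≤ _ := by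
      rw [hconst]
      linarith

/-- The sequence `n ↦ μ₅(n)/C(n,5)` converges, and its limit `c₅` satisfies
`c₅ ≥ (5√5 − 11)/4`. -/
theorem c5_exists_and_lower_bound :
    ∃ c₅ : ℝ,
      Filter.Tendsto (fun n : ℕ => (mu 5 n : ℝ) / (n.choose 5 : ℝ))
        Filter.atTop (nhds c₅) ∧
      c₅ ≥ (5 * Real.sqrt 5 - 11) / 4 := by
  have hbdd : BddAbove (Set.range fun m : ℕ => (mu 5 (m + 5) : ℝ) / (m + 5).choose 5) :=
    ⟨1, by rintro _ ⟨m, rfl⟩; exact mu_div_choose_le_one 5 (m + 5)⟩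
  have hlim := tendsto_atTop_ciSup (monotone_mu_div_choose 5) hbdd
  refine ⟨_, (Filter.tendsto_add_atTop_iff_nat 5).1 hlim, ?_⟩
  have herr : Filter.Tendsto (fun m : ℕ => (5 * Real.sqrt 5 - 11) / 4 - 50 * (1 / ((m : ℝ) + 1)))
      Filter.atTop (nhds ((5 * Real.sqrt 5 - 11) / 4 - 50 * 0)) :=
    (tendsto_one_div_add_atTop_nhds_zero_nat.const_mul 50).const_sub _
  rw [mul_zero, sub_zero] at herr
  exact le_of_tendsto_of_tendsto' herr hlim five_mul_sqrt_five_sub_le
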